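/- Let q : X → Y be a (K,C)-quasi-isometry between geodesic metric spaces, let e ∈ X, and let N be a Morse gauge. Then there exists a Morse gauge N', depending only on N, K and C, such that: q sends every sequence in X^(N)_e converging at infinity to a sequence in Y^(N')_{q(e)} converging at infinity, sends equivalent sequences to equivalent sequences, and hence induces an injective map ∂q : ∂X^(N)_e → ∂Y^(N')_{q(e)}; moreover, for any visual metric on ∂X^(N)_e and any visual metric on ∂Y^(N')_{q(e)}, the map ∂q is a quasi-symmetry onto its image. -/

import Mathlib

open Set Filter

section Defs

variable {X : Type*} [MetricSpace X]

/-- A geodesic segment of length `L`, parametrized by arc length on `[0, L]`. -/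
def IsGeodesicSeg (γ : ℝ → X) (L : ℝ) : Prop :=
  0 ≤ L ∧ ∀ s ∈ Icc (0:ℝ) L, ∀ t ∈ Icc (0:ℝ) L, dist (γ s) (γ t) = |s - t|

/-- A geodesic from `x` to `y`, parametrized by arc length on `[0, dist x y]`. -/
def IsGeodesicFromTo (γ : ℝ → X) (x y : X) : Prop :=
  IsGeodesicSeg γ (dist x y) ∧ γ 0 = x ∧ γ (dist x y) = y

/-- A geodesic ray, parametrized by arc length on `[0, ∞)`. -/
def IsGeodesicRay (ℓ : ℝ → X) : Prop :=
  ∀ s ∈ Ici (0:ℝ), ∀ t ∈ Ici (0:ℝ), dist (ℓ s) (ℓ t) = |s - t|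

/-- A geodesic metric space: any two points are joined by a geodesic. -/
def GeodesicSpace (X : Type*) [MetricSpace X] : Prop :=
  ∀ x y : X, ∃ γ : ℝ → X, IsGeodesicFromTo γ x y

/-- A `(K, C)`-quasi-geodesic defined on the interval `I ⊆ ℝ`. -/
def IsQuasiGeodesicOn (K C : ℝ) (I : Set ℝ) (σ : ℝ → X) : Prop :=
  ∀ s ∈ I, ∀ t ∈ I,
    |s - t| / K - C ≤ dist (σ s) (σ t) ∧ dist (σ s) (σ t) ≤ K * |s - t| + C

/-- A Morse gauge: a nonnegative real `N K C` for every `K ≥ 1`, `C ≥ 0`. -/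
def IsMorseGauge (N : ℝ → ℝ → ℝ) : Prop :=
  ∀ K C : ℝ, 1 ≤ K → 0 ≤ C → 0 ≤ N K C

/-- A subset `G ⊆ X` is `N`-Morse if for all `K ≥ 1`, `C ≥ 0`, every
`(K,C)`-quasi-geodesic with endpoints on `G` is contained in the closed
`N K C`-neighbourhood of `G`. -/
def IsMorseSet (N : ℝ → ℝ → ℝ) (G : Set X) : Prop :=
  ∀ K C : ℝ, 1 ≤ K → 0 ≤ C → ∀ a b : ℝ, a ≤ b → ∀ σ : ℝ → X,
    IsQuasiGeodesicOn K C (Icc a b) σ → σ a ∈ G → σ b ∈ G →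
    ∀ s ∈ Icc a b, ∃ g ∈ G, dist (σ s) g ≤ N K C

/-- An `N`-Morse geodesic from `x` to `y`. -/
def IsMorseGeodesicFromTo (N : ℝ → ℝ → ℝ) (γ : ℝ → X) (x y : X) : Prop :=
  IsGeodesicFromTo γ x y ∧ IsMorseSet N (γ '' Icc 0 (dist x y))

/-- An `N`-Morse geodesic ray. -/
def IsMorseRay (N : ℝ → ℝ → ℝ) (ℓ : ℝ → X) : Prop :=
  IsGeodesicRay ℓ ∧ IsMorseSet N (ℓ '' Ici 0)

/-- The stratum `X^(N)_e`: points joined to `e` by an `N`-Morse geodesic. -/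
def morseStratum (N : ℝ → ℝ → ℝ) (e : X) : Set X :=
  {y | ∃ γ : ℝ → X, IsMorseGeodesicFromTo N γ e y}

/-- The Gromov product `(x·y)_w`. -/
noncomputable def gprod (w x y : X) : ℝ := (dist w x + dist w y - dist x y) / 2

/-- A `B`-quasi-convex subset: geodesics with endpoints in `Y` stay in the
closed `B`-neighbourhood of `Y`. -/
def IsQuasiConvex (B : ℝ) (Y : Set X) : Prop :=
  ∀ x ∈ Y, ∀ y ∈ Y, ∀ γ : ℝ → X, IsGeodesicFromTo γ x y →
    ∀ s ∈ Icc (0:ℝ) (dist x y), ∃ g ∈ Y, dist (γ s) g ≤ B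

/-- An `N`-stable subset: quasi-convex, and any two of its points are joined
by an `N`-Morse geodesic of `X`. -/
def IsStableSubset (N : ℝ → ℝ → ℝ) (Y : Set X) : Prop :=
  (∃ B : ℝ, 0 ≤ B ∧ IsQuasiConvex B Y) ∧
    ∀ x ∈ Y, ∀ y ∈ Y, ∃ γ : ℝ → X, IsMorseGeodesicFromTo N γ x y

variable {Y : Type*} [MetricSpace Y]

/-- A `(K,C)`-quasi-isometric embedding. -/
def IsQIEmbedding (K C : ℝ) (q : X → Y) : Prop :=
  ∀ x x' : X,
    dist x x' / K - C ≤ dist (q x) (q x') ∧ dist (q x) (q x') ≤ K * dist x x' + C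

/-- A `(K,C)`-quasi-isometry. -/
def IsQuasiIsometry (K C : ℝ) (q : X → Y) : Prop :=
  IsQIEmbedding K C q ∧ ∀ y : Y, ∃ x : X, dist y (q x) ≤ C

end Defs

section Boundary

variable {X : Type*} [MetricSpace X]

/-- A sequence converges at infinity with respect to the basepoint `e`. -/
def ConvAtInf (e : X) (f : ℕ → X) : Prop :=
  Tendsto (fun p : ℕ × ℕ => gprod e (f p.1) (f p.2)) atTop atTop

/-- Two sequences converging at infinity are equivalent. -/
def EquivAtInf (e : X) (f g : ℕ → X) : Prop :=
  Tendsto (fun p : ℕ × ℕ => gprod e (f p.1) (g p.2)) atTop atTop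

/-- Sequences in `S` converging at infinity. -/
abbrev BSeq (S : Set X) (e : X) : Type _ :=
  {f : ℕ → X // (∀ n, f n ∈ S) ∧ ConvAtInf e f}

/-- The sequential boundary of `S ⊆ X` with basepoint `e`: sequences in `S`
converging at infinity, up to equivalence. -/
def SeqBoundary (S : Set X) (e : X) : Type _ :=
  Quot (fun f g : BSeq S e => EquivAtInf e f.1 g.1)

/-- The boundary point represented by a convergent sequence. -/
def SeqBoundary.mk {S : Set X} {e : X} (f : BSeq S e) : SeqBoundary S e :=
  Quot.mk _ f

/-- The liminf of Gromov products of two sequences, valued in `EReal`. -/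
noncomputable def seqGP (e : X) (f g : ℕ → X) : EReal :=
  Filter.liminf (fun p : ℕ × ℕ => ((gprod e (f p.1) (g p.2) : ℝ) : EReal)) atTop

/-- The Gromov product of two boundary points: the supremum over representing
sequences of the liminf of Gromov products. -/
noncomputable def bGP (S : Set X) (e : X) (ξ η : SeqBoundary S e) : EReal :=
  sSup {r : EReal | ∃ f g : BSeq S e,
    SeqBoundary.mk f = ξ ∧ SeqBoundary.mk g = η ∧ r = seqGP e f.1 g.1}

open Classical in
/-- `exp (−ε·r)` for an extended real `r`, with value `0` at `r = ⊤`. -/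
noncomputable def visGauge (ε : ℝ) (r : EReal) : ℝ :=
  if r = ⊤ then 0 else Real.exp (-ε * r.toReal)

/-- `d` is a visual metric on the sequential boundary of `S`:
a metric comparable to `exp(−ε·(Gromov product))` for some parameter `ε > 0`. -/
def IsVisualMetric (S : Set X) (e : X)
    (d : SeqBoundary S e → SeqBoundary S e → ℝ) : Prop :=
  (∀ ξ η, 0 ≤ d ξ η) ∧ (∀ ξ η, d ξ η = d η ξ) ∧
  (∀ ξ η ζ, d ξ ζ ≤ d ξ η + d η ζ) ∧ (∀ ξ η, d ξ η = 0 ↔ ξ = η) ∧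
  ∃ ε : ℝ, 0 < ε ∧ ∃ k₁ : ℝ, 0 < k₁ ∧ ∃ k₂ : ℝ, 0 < k₂ ∧
    ∀ ξ η, k₁ * visGauge ε (bGP S e ξ η) ≤ d ξ η ∧
      d ξ η ≤ k₂ * visGauge ε (bGP S e ξ η)

/-- `η` is (the restriction of) a self-homeomorphism of `[0,∞)`. -/
def IsHomeoIci (η : ℝ → ℝ) : Prop :=
  ContinuousOn η (Ici 0) ∧ StrictMonoOn η (Ici 0) ∧ η 0 = 0 ∧
    Tendsto η atTop atTop ∧ ∀ t ∈ Ici (0:ℝ), 0 ≤ η t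

/-- `F` is a quasi-symmetry onto its image, for the "distances" `dA`, `dB`. -/
def IsQuasiSymmetryOnto {A B : Type*} (dA : A → A → ℝ) (dB : B → B → ℝ)
    (F : A → B) : Prop :=
  Function.Injective F ∧ ∃ η : ℝ → ℝ, IsHomeoIci η ∧
    ∀ x y z : A, x ≠ y → x ≠ z → y ≠ z →
      dB (F x) (F y) / dB (F x) (F z) ≤ η (dA x y / dA x z)

end Boundary

/-- `X` (with basepoint `x`) is stably subsumed by `Y` (with basepoint `y`):
every stratum of `X` quasi-isometrically embeds in some stratum of `Y`. -/
def StablySubsumed (X Y : Type*) [MetricSpace X] [MetricSpace Y]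
    (x : X) (y : Y) : Prop :=
  ∀ N : ℝ → ℝ → ℝ, IsMorseGauge N →
    ∃ N' : ℝ → ℝ → ℝ, IsMorseGauge N' ∧
      ∃ K C : ℝ, 1 ≤ K ∧ 0 ≤ C ∧ ∃ f : X → Y,
        (∀ a ∈ morseStratum N x, f a ∈ morseStratum N' y) ∧
        ∀ a ∈ morseStratum N x, ∀ b ∈ morseStratum N x,
          dist a b / K - C ≤ dist (f a) (f b) ∧ dist (f a) (f b) ≤ K * dist a b + C

/-- Durham–Taylor stability of `f : Y → X`. -/
def DTStable {Y X : Type*} [MetricSpace Y] [MetricSpace X] (f : Y → X) : Prop :=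
  ∀ K C : ℝ, 1 ≤ K → 0 ≤ C → ∃ R : ℝ, 0 ≤ R ∧
    ∀ a₁ b₁ a₂ b₂ : ℝ, a₁ ≤ b₁ → a₂ ≤ b₂ → ∀ σ₁ σ₂ : ℝ → X,
      IsQuasiGeodesicOn K C (Icc a₁ b₁) σ₁ → IsQuasiGeodesicOn K C (Icc a₂ b₂) σ₂ →
      σ₁ a₁ = σ₂ a₂ → σ₁ b₁ = σ₂ b₂ →
      σ₁ a₁ ∈ Set.range f → σ₁ b₁ ∈ Set.range f →
      (∀ s ∈ Icc a₁ b₁, ∃ t ∈ Icc a₂ b₂, dist (σ₁ s) (σ₂ t) ≤ R) ∧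
      (∀ t ∈ Icc a₂ b₂, ∃ s ∈ Icc a₁ b₁, dist (σ₁ s) (σ₂ t) ≤ R)

section Aux

theorem aux_ivt (h : ℝ → ℝ) (a b A B v : ℝ) (hab : a ≤ b) (hA : 0 ≤ A)
    (hc : ∀ s ∈ Icc a b, ∀ t ∈ Icc a b, |h s - h t| ≤ A * |s - t| + B)
    (h1 : h a ≤ v) (h2 : v ≤ h b) : ∃ u ∈ Icc a b, |h u - v| ≤ A + B := by
  set S : Set ℝ := {s | s ∈ Icc a b ∧ h s ≤ v} with hS
  have hne : S.Nonempty := ⟨a, ⟨le_rfl, hab⟩, h1⟩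
  have hbd : BddAbove S := ⟨b, fun s hs => hs.1.2⟩
  obtain ⟨s, hs, hs'⟩ := exists_lt_of_lt_csSup hne (show sSup S - 1/2 < sSup S by linarith)
  have hle : s ≤ sSup S := le_csSup hbd hs
  have hsb : sSup S ≤ b := csSup_le hne (fun s hs => hs.1.2)
  have key : ∃ t ∈ Icc a b, v ≤ h t ∧ |t - s| ≤ 1 := by
    rcases hsb.eq_or_lt with hEq | hlt
    · refine ⟨b, ⟨hab, le_rfl⟩, h2, ?_⟩
      rw [abs_le]; constructor <;> linarith
    · refine ⟨min (sSup S + 1/2) b, ⟨?_, min_le_right _ _⟩, ?_, ?_⟩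
      · have := hs.1.1
        exact le_min (by linarith) hab
      · by_contra hcon
        push Not at hcon
        have hm : min (sSup S + 1/2) b ∈ S :=
          ⟨⟨le_min (by linarith [hs.1.1]) hab, min_le_right _ _⟩, hcon.le⟩
        have := le_csSup hbd hm
        have h3 : sSup S < min (sSup S + 1/2) b := lt_min (by linarith) hlt
        linarith
      · have h3 : sSup S < min (sSup S + 1/2) b := lt_min (by linarith) hlt
        have h4 := min_le_left (sSup S + 1/2) b
        rw [abs_le]; constructor <;> linarith
  obtain ⟨t, ht, hvt, hts⟩ := key
  refine ⟨s, hs.1, ?_⟩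
  have h3 := hc t ht s hs.1
  have h4 : A * |t - s| ≤ A * 1 := mul_le_mul_of_nonneg_left hts hA
  have h5 := abs_le.1 h3
  have := hs.2
  rw [abs_le]; constructor <;> linarith

variable {X : Type*} [MetricSpace X]

theorem aux_near_ends {N : ℝ → ℝ → ℝ} {G : Set X} (hN : IsMorseGauge N)
    (hG : IsMorseSet N G) {K C R : ℝ}
    (hK : 1 ≤ K) (hC : 0 ≤ C) (hR : 0 ≤ R) {a b : ℝ} (hab : a ≤ b) {σ : ℝ → X}
    (hσ : IsQuasiGeodesicOn K C (Icc a b) σ)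
    (ha : ∃ g ∈ G, dist (σ a) g ≤ R) (hb : ∃ g ∈ G, dist (σ b) g ≤ R) :
    ∀ s ∈ Icc a b, ∃ g ∈ G, dist (σ s) g ≤ N K (C + 2 * R) + R := by
  obtain ⟨g, hg, hga⟩ := ha
  obtain ⟨g', hg', hgb⟩ := hb
  intro s hs
  have hNn := hN K (C + 2 * R) hK (by linarith)
  by_cases hsa : s = a
  · subst hsa; exact ⟨g, hg, by linarith⟩
  by_cases hsb : s = b
  · subst hsb; exact ⟨g', hg', by linarith⟩
  have hne : a ≠ b := by
    rintro rfl; exact hsa (le_antisymm hs.2 hs.1)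
  classical
  set τ : ℝ → X := fun u => if u = a then g else if u = b then g' else σ u with hτ
  have hclose : ∀ u, dist (σ u) (τ u) ≤ R := by
    intro u
    simp only [hτ]
    split_ifs with h1 h2
    · subst h1; exact hga
    · subst h2; exact hgb
    · simpa using hR
  have hq : IsQuasiGeodesicOn K (C + 2 * R) (Icc a b) τ := by
    intro u hu v hv
    have h1 := hσ u hu v hv
    have h2 := hclose u
    have h3 := hclose v
    have h4 := dist_triangle4 (σ u) (τ u) (τ v) (σ v)
    have h5 := dist_triangle4 (τ u) (σ u) (σ v) (τ v)
    rw [dist_comm (τ v) (σ v)] at h4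
    rw [dist_comm (τ u) (σ u)] at h5
    constructor <;> linarith [h1.1, h1.2]
  have ha' : τ a ∈ G := by simp [hτ, hg]
  have hb' : τ b ∈ G := by simp [hτ, hne.symm, hg']
  obtain ⟨k, hk, hk'⟩ := hG K (C + 2 * R) hK (by linarith) a b hab τ hq ha' hb' s hs
  refine ⟨k, hk, ?_⟩
  have : τ s = σ s := by simp [hτ, hsa, hsb]
  rw [this] at hk'
  linarith

theorem aux_converse {γ : ℝ → X} {L : ℝ} (hγ : IsGeodesicSeg γ L) {K C D R : ℝ}
    (hK : 1 ≤ K) (hC : 0 ≤ C) (hD : 0 ≤ D) (hR : 0 ≤ R) {a b : ℝ} (hab : a ≤ b) {σ : ℝ → X}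
    (hσ : IsQuasiGeodesicOn K C (Icc a b) σ)
    (ha : dist (σ a) (γ 0) ≤ R) (hb : dist (σ b) (γ L) ≤ R)
    (hn : ∀ s ∈ Icc a b, ∃ g ∈ γ '' Icc 0 L, dist (σ s) g ≤ D) :
    ∀ t ∈ Icc 0 L, ∃ s ∈ Icc a b, dist (σ s) (γ t) ≤ 2 * D + K + C + 2 * R := by
  intro t ht
  have h0 : (0:ℝ) ∈ Icc 0 L := ⟨le_rfl, hγ.1⟩
  have hL : L ∈ Icc 0 L := ⟨hγ.1, le_rfl⟩
  by_cases h1 : dist (γ 0) (σ a) ≤ t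
  · by_cases h2 : t ≤ dist (γ 0) (σ b)
    · obtain ⟨u, hu, hut⟩ := aux_ivt (fun s => dist (γ 0) (σ s)) a b K C t hab (by linarith)
        (by
          intro s hs s' hs'
          have h3 := (hσ s hs s' hs').2
          have h4 : |dist (γ 0) (σ s) - dist (γ 0) (σ s')| ≤ dist (σ s) (σ s') := by
            rw [dist_comm (γ 0), dist_comm (γ 0)]
            exact abs_dist_sub_le _ _ _
          exact h4.trans h3) h1 h2
      refine ⟨u, hu, ?_⟩
      obtain ⟨_, ⟨v, hv, rfl⟩, huv⟩ := hn u hu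
      have h3 := hγ.2 0 h0 v hv
      have h4 := hγ.2 v hv t ht
      have h5 := dist_triangle (γ 0) (γ v) (σ u)
      have h6 := dist_triangle (γ 0) (σ u) (γ v)
      have h7 := dist_triangle (σ u) (γ v) (γ t)
      rw [dist_comm (γ v) (σ u)] at h5
      rw [zero_sub, abs_neg, abs_of_nonneg hv.1] at h3
      have h8 := abs_le.1 hut
      have h9 : |v - t| ≤ D + K + C := by
        rw [abs_le]; constructor <;> linarith
      linarith
    · refine ⟨b, ⟨hab, le_rfl⟩, ?_⟩
      have h3 := hγ.2 0 h0 L hL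
      have h4 := hγ.2 L hL t ht
      have h5 := dist_triangle (γ 0) (σ b) (γ L)
      have h6 := dist_triangle (σ b) (γ L) (γ t)
      rw [zero_sub, abs_neg, abs_of_nonneg hγ.1] at h3
      rw [abs_of_nonneg (by linarith [ht.2])] at h4
      linarith
  · refine ⟨a, ⟨le_rfl, hab⟩, ?_⟩
    have h4 := hγ.2 0 h0 t ht
    rw [zero_sub, abs_neg, abs_of_nonneg ht.1] at h4
    have h6 := dist_triangle (σ a) (γ 0) (γ t)
    rw [dist_comm (γ 0)] at h1
    linarith

/-- Concatenation of a shortest path and a geodesic. -/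
theorem aux_concat {e p : X} {τ β : ℝ → X} {L : ℝ} (hτ : IsGeodesicFromTo τ e p)
    (hβ : IsGeodesicSeg β L) (hβ0 : β 0 = p)
    (hmin : ∀ s ∈ Icc 0 L, dist e p ≤ dist e (β s)) :
    IsQuasiGeodesicOn 3 0 (Icc 0 (dist e p + L))
      (fun s => if s ≤ dist e p then τ s else β (s - dist e p)) := by
  have hl : 0 ≤ dist e p := dist_nonneg
  have hmix : ∀ s t, 0 ≤ s → s ≤ dist e p → dist e p ≤ t → t ≤ dist e p + L →
      (t - s) / 3 ≤ dist (τ s) (β (t - dist e p)) ∧ dist (τ s) (β (t - dist e p)) ≤ t - s := by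
    intro s t hs0 hs ht htL
    have hs' : s ∈ Icc 0 (dist e p) := ⟨hs0, hs⟩
    have ht' : t - dist e p ∈ Icc 0 L := ⟨by linarith, by linarith⟩
    have h1 := hτ.1.2 0 ⟨le_rfl, hl⟩ s hs'
    have h2 := hτ.1.2 s hs' (dist e p) ⟨hl, le_rfl⟩
    rw [hτ.2.2] at h2
    rw [hτ.2.1] at h1
    have h3 := hβ.2 0 ⟨le_rfl, hβ.1⟩ _ ht'
    rw [hβ0] at h3
    rw [zero_sub, abs_neg, abs_of_nonneg ht'.1] at h3
    rw [zero_sub, abs_neg, abs_of_nonneg hs0] at h1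
    rw [abs_sub_comm, abs_of_nonneg (by linarith)] at h2
    have h4 := hmin _ ht'
    have h5 := dist_triangle e (τ s) (β (t - dist e p))
    have h6 := dist_triangle p (τ s) (β (t - dist e p))
    have h7 := dist_triangle (τ s) p (β (t - dist e p))
    rw [dist_comm p (τ s)] at h6
    constructor <;> linarith
  intro s hs t ht
  simp only [sub_zero, add_zero]
  by_cases h1 : s ≤ dist e p
  · by_cases h2 : t ≤ dist e p
    · simp only [h1, h2, if_true]
      have h3 := hτ.1.2 s ⟨hs.1, h1⟩ t ⟨ht.1, h2⟩
      have := abs_nonneg (s - t)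
      constructor <;> linarith
    · simp only [h1, h2, if_true, if_false]
      have h3 := hmix s t hs.1 h1 (by linarith) ht.2
      rw [abs_sub_comm, abs_of_nonneg (by linarith)]
      constructor <;> linarith
  · by_cases h2 : t ≤ dist e p
    · simp only [h1, h2, if_true, if_false]
      have h3 := hmix t s ht.1 h2 (by linarith) hs.2
      rw [abs_of_nonneg (by linarith), dist_comm]
      constructor <;> linarith
    · simp only [h1, h2, if_false]
      have h3 := hβ.2 (s - dist e p) ⟨by linarith, by linarith [hs.2]⟩ (t - dist e p)
        ⟨by linarith, by linarith [ht.2]⟩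
      rw [show s - dist e p - (t - dist e p) = s - t by ring] at h3
      have := abs_nonneg (s - t)
      constructor <;> linarith

theorem aux_follow {N : ℝ → ℝ → ℝ} {e x p : X} {γ τ β : ℝ → X} {L : ℝ}
    (hγ : IsMorseGeodesicFromTo N γ e x) (hτ : IsGeodesicFromTo τ e p)
    (hβ : IsGeodesicSeg β L) (hβ0 : β 0 = p) (hβL : β L = x)
    (hmin : ∀ s ∈ Icc 0 L, dist e p ≤ dist e (β s)) :
    ∀ t, 0 ≤ t → t ≤ dist e p → t ≤ dist e x → dist (γ t) (τ t) ≤ 2 * N 3 0 := by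
  intro t ht0 htp htx
  have hc := aux_concat hτ hβ hβ0 hmin
  have hl : 0 ≤ dist e p := dist_nonneg
  have hlx : 0 ≤ dist e x := dist_nonneg
  have h0 : (0:ℝ) ∈ Icc 0 (dist e x) := ⟨le_rfl, hlx⟩
  obtain ⟨_, ⟨v, hv, rfl⟩, hd⟩ := hγ.2 3 0 (by norm_num) le_rfl 0 (dist e p + L)
    (by linarith [hβ.1]) _ hc
    (by
      simp only [hl, if_true]
      exact ⟨0, h0, by rw [hγ.1.2.1, hτ.2.1]⟩)
    (by
      refine ⟨dist e x, ⟨hlx, le_rfl⟩, ?_⟩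
      rw [hγ.1.2.2]
      by_cases hL : L ≤ 0
      · have hL0 : L = 0 := le_antisymm hL hβ.1
        subst hL0
        simp [← hβ0, hβL]
        rw [← hβL, hβ0, hτ.2.2]
      · simp [hL, hβL]) t ⟨ht0, by linarith [hβ.1]⟩
  simp only [htp, if_true] at hd
  have h1 := hγ.1.1.2 0 h0 v hv
  have h2 := hτ.1.2 0 ⟨le_rfl, hl⟩ t ⟨ht0, htp⟩
  rw [hτ.2.1] at h2
  rw [hγ.1.2.1] at h1
  rw [zero_sub, abs_neg, abs_of_nonneg hv.1] at h1
  rw [zero_sub, abs_neg, abs_of_nonneg ht0] at h2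
  have h3 := dist_triangle e (γ v) (τ t)
  have h4 := dist_triangle e (τ t) (γ v)
  have h5 := hγ.1.1.2 t ⟨ht0, htx⟩ v hv
  have h6 := dist_triangle (γ t) (γ v) (τ t)
  rw [dist_comm (γ v) (τ t)] at h3 h6
  have h7 : |t - v| ≤ N 3 0 := by rw [abs_le]; constructor <;> linarith
  linarith

theorem gprod_le_left (e x y : X) : gprod e x y ≤ dist e x := by
  unfold gprod
  have := dist_triangle e x y
  linarith

theorem gprod_comm' (e x y : X) : gprod e x y = gprod e y x := by
  unfold gprod
  rw [dist_comm x y]; ring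

theorem gprod_le_right (e x y : X) : gprod e x y ≤ dist e y := by
  rw [gprod_comm']; exact gprod_le_left _ _ _

theorem gprod_nonneg' (e x y : X) : 0 ≤ gprod e x y := by
  unfold gprod
  have := dist_triangle x e y
  rw [dist_comm x e] at this
  linarith

theorem aux_fellow (hX : GeodesicSpace X) {N : ℝ → ℝ → ℝ} {e x y : X} {γ γ' : ℝ → X}
    (hγ : IsMorseGeodesicFromTo N γ e x) (hγ' : IsMorseGeodesicFromTo N γ' e y) :
    ∀ t, 0 ≤ t → t ≤ gprod e x y → dist (γ t) (γ' t) ≤ 4 * N 3 0 := by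
  intro t ht0 ht
  obtain ⟨α, hα⟩ := hX x y
  have hlxy : 0 ≤ dist x y := dist_nonneg
  have hcont : ContinuousOn (fun s => dist e (α s)) (Icc 0 (dist x y)) := by
    refine (continuous_const.dist continuous_id : Continuous (fun z : X => dist e z)).comp_continuousOn ?_
    apply LipschitzOnWith.continuousOn (K := 1)
    apply LipschitzOnWith.of_dist_le_mul
    intro s hs u hu
    rw [hα.1.2 s hs u hu, Real.dist_eq]; simp
  obtain ⟨m, hm, hmin⟩ := isCompact_Icc.exists_isMinOn ⟨0, le_rfl, hlxy⟩ hcont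
  have hmin' : ∀ s ∈ Icc 0 (dist x y), dist e (α m) ≤ dist e (α s) := fun s hs => hmin hs
  obtain ⟨τ, hτ⟩ := hX e (α m)
  have h1 := hα.1.2 0 ⟨le_rfl, hlxy⟩ m hm
  have h2 := hα.1.2 m hm (dist x y) ⟨hlxy, le_rfl⟩
  rw [hα.2.1, zero_sub, abs_neg, abs_of_nonneg hm.1] at h1
  rw [hα.2.2, abs_sub_comm, abs_of_nonneg (by linarith [hm.2])] at h2
  have hgp : gprod e x y ≤ dist e (α m) := by
    unfold gprod
    have h3 := dist_triangle e (α m) x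
    have h4 := dist_triangle e (α m) y
    rw [dist_comm (α m) x] at h3
    linarith
  have hf1 := aux_follow (L := m) (β := fun s => α (m - s)) hγ hτ
    ⟨hm.1, by
      intro s hs u hu
      have hs2 := hs.2
      have hu2 := hu.2
      have h3 := hα.1.2 (m - s) ⟨by linarith, by linarith [hm.2, hs.1]⟩ (m - u)
        ⟨by linarith, by linarith [hm.2, hu.1]⟩
      simp only [h3]
      rw [show m - s - (m - u) = u - s by ring, abs_sub_comm]⟩ (by simp) (by simp [hα.2.1])
    (by
      intro s hs
      exact hmin' _ ⟨by linarith [hs.2], by linarith [hm.2, hs.1]⟩) t ht0 (by linarith)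
      (ht.trans (gprod_le_left _ _ _))
  have hf2 := aux_follow (L := dist x y - m) (β := fun s => α (m + s)) hγ' hτ
    ⟨by linarith [hm.2], by
      intro s hs u hu
      have hs2 := hs.2
      have hu2 := hu.2
      have h3 := hα.1.2 (m + s) ⟨by linarith [hm.1, hs.1], by linarith [hm.2, hs.1]⟩ (m + u)
        ⟨by linarith [hm.1, hu.1], by linarith [hm.2, hu.1]⟩
      simp only [h3]
      rw [show m + s - (m + u) = s - u by ring]⟩ (by simp) (by simp [hα.2.2])
    (by
      intro s hs
      exact hmin' _ ⟨by linarith [hs.1, hm.1], by linarith [hm.2, hs.2]⟩) t ht0 (by linarith)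
      (ht.trans (gprod_le_right _ _ _))
  have h3 := dist_triangle (γ t) (τ t) (γ' t)
  rw [dist_comm (τ t) (γ' t)] at h3
  linarith

theorem aux_gprod_lower {e x y : X} {γ γ' : ℝ → X}
    (hγ : IsGeodesicFromTo γ e x) (hγ' : IsGeodesicFromTo γ' e y) {s t E : ℝ}
    (hs : s ∈ Icc 0 (dist e x)) (ht : t ∈ Icc 0 (dist e y)) (hE : dist (γ s) (γ' t) ≤ E) :
    s + t - E ≤ 2 * gprod e x y := by
  have hx : 0 ≤ dist e x := dist_nonneg
  have hy : 0 ≤ dist e y := dist_nonneg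
  have h1 := hγ.1.2 s hs (dist e x) ⟨hx, le_rfl⟩
  have h2 := hγ'.1.2 t ht (dist e y) ⟨hy, le_rfl⟩
  rw [hγ.2.2, abs_sub_comm, abs_of_nonneg (by linarith [hs.2])] at h1
  rw [hγ'.2.2, abs_sub_comm, abs_of_nonneg (by linarith [ht.2])] at h2
  have h3 := dist_triangle4 x (γ s) (γ' t) y
  rw [dist_comm x (γ s)] at h3
  unfold gprod
  linarith

theorem aux_param {e x z : X} {γ : ℝ → X} (hγ : IsGeodesicFromTo γ e x) {s D : ℝ}
    (hs : s ∈ Icc 0 (dist e x)) (hD : dist z (γ s) ≤ D) : |dist e z - s| ≤ D := by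
  have h1 := hγ.1.2 0 ⟨le_rfl, dist_nonneg⟩ s hs
  rw [hγ.2.1, zero_sub, abs_neg, abs_of_nonneg hs.1] at h1
  have h2 := dist_triangle e (γ s) z
  have h3 := dist_triangle e z (γ s)
  rw [dist_comm (γ s) z] at h2
  rw [abs_le]; constructor <;> linarith

/-- Four point inequality on the stratum. -/
theorem aux_four (hX : GeodesicSpace X) {N : ℝ → ℝ → ℝ} {e x y z : X}
    (hx : x ∈ morseStratum N e) (hy : y ∈ morseStratum N e) (hz : z ∈ morseStratum N e) :
    min (gprod e x y) (gprod e y z) - 4 * N 3 0 ≤ gprod e x z := by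
  obtain ⟨γx, hγx⟩ := hx
  obtain ⟨γy, hγy⟩ := hy
  obtain ⟨γz, hγz⟩ := hz
  set t := min (gprod e x y) (gprod e y z) with ht
  have ht0 : 0 ≤ t := le_min (gprod_nonneg' _ _ _) (gprod_nonneg' _ _ _)
  have h1 := aux_fellow hX hγx hγy t ht0 (min_le_left _ _)
  have h2 := aux_fellow hX hγy hγz t ht0 (min_le_right _ _)
  have h3 := dist_triangle (γx t) (γy t) (γz t)
  have h4 := aux_gprod_lower (s := t) (t := t) (E := 8 * N 3 0) hγx.1 hγz.1
    ⟨ht0, (min_le_left _ _).trans (gprod_le_left _ _ _)⟩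
    ⟨ht0, (min_le_right _ _).trans (gprod_le_right _ _ _)⟩ (by linarith)
  linarith

variable {Y : Type*} [MetricSpace Y]

theorem aux_qi_upper {K C : ℝ} (hK : 1 ≤ K) {q : X → Y} (hq : IsQIEmbedding K C q) (a b : X) :
    dist a b ≤ K * (dist (q a) (q b) + C) := by
  have h := (hq a b).1
  have hK0 : 0 < K := by linarith
  have h1 : dist a b / K ≤ dist (q a) (q b) + C := by linarith
  rw [div_le_iff₀ hK0] at h1
  linarith

theorem aux_lift {K C K₁ C₁ : ℝ} (hK : 1 ≤ K) (hC : 0 ≤ C) (hK₁ : 1 ≤ K₁) (hC₁ : 0 ≤ C₁)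
    {q : X → Y} (hq : IsQIEmbedding K C q) {I : Set ℝ} {σ : ℝ → Y} {τ : ℝ → X}
    (hσ : IsQuasiGeodesicOn K₁ C₁ I σ) (hτ : ∀ s, dist (σ s) (q (τ s)) ≤ C) :
    IsQuasiGeodesicOn (K * K₁) (K * (C₁ + 3 * C)) I τ := by
  intro s hs t ht
  have h1 := hσ s hs t ht
  have h2 := hτ s
  have h3 := hτ t
  have h4 := dist_triangle4 (σ s) (q (τ s)) (q (τ t)) (σ t)
  have h5 := dist_triangle4 (q (τ s)) (σ s) (σ t) (q (τ t))
  rw [dist_comm (q (τ t)) (σ t)] at h4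
  rw [dist_comm (q (τ s)) (σ s)] at h5
  have h6 := aux_qi_upper hK hq (τ s) (τ t)
  have h7 := (hq (τ s) (τ t)).2
  have hK0 : 0 < K := by linarith
  have hK10 : 0 < K₁ := by linarith
  constructor
  · have h8 : |s - t| / K₁ ≤ K * dist (τ s) (τ t) + (C₁ + 3 * C) := by linarith [h1.1]
    have h9 : |s - t| / (K * K₁) ≤ dist (τ s) (τ t) + (C₁ + 3 * C) / K := by
      rw [mul_comm, ← div_div, div_le_iff₀ hK0]
      have : (dist (τ s) (τ t) + (C₁ + 3 * C) / K) * K = K * dist (τ s) (τ t) + (C₁ + 3 * C) := by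
        field_simp
      linarith
    have h10 : (C₁ + 3 * C) / K ≤ K * (C₁ + 3 * C) := by
      rw [div_le_iff₀ hK0]
      have : 0 ≤ C₁ + 3 * C := by positivity
      nlinarith [mul_nonneg this (show 0 ≤ K - 1 by linarith), mul_nonneg (mul_nonneg this (show 0 ≤ K - 1 by linarith)) hK0.le]
    linarith
  · have h8 : dist (q (τ s)) (q (τ t)) + C ≤ K₁ * |s - t| + (C₁ + 3 * C) := by linarith [h1.2]
    have h9 := mul_le_mul_of_nonneg_left h8 hK0.le
    linarith

theorem aux_gauge (N : ℝ → ℝ → ℝ) (hN : IsMorseGauge N)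
    (K C : ℝ) (hK : 1 ≤ K) (hC : 0 ≤ C) :
    ∃ N' : ℝ → ℝ → ℝ, IsMorseGauge N' ∧
      ∀ (X Y : Type*) [MetricSpace X] [MetricSpace Y],
        GeodesicSpace X → GeodesicSpace Y →
        ∀ q : X → Y, IsQuasiIsometry K C q → ∀ e : X,
          ∀ x ∈ morseStratum N e, q x ∈ morseStratum N' (q e) := by
  have hK0 : 0 ≤ K := by linarith
  have hKC : 0 ≤ K * C := mul_nonneg hK0 hC
  obtain ⟨R0, hR0⟩ : ∃ R0, R0 = 2 * (K * C) := ⟨_, rfl⟩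
  have hR0n : 0 ≤ R0 := by linarith
  obtain ⟨M, hM⟩ : ∃ M, M = N (K * 1) (K * (0 + 3 * C) + 2 * R0) + R0 := ⟨_, rfl⟩
  have hMn : 0 ≤ M := by
    have := hN (K * 1) (K * (0 + 3 * C) + 2 * R0) (by linarith) (by nlinarith)
    linarith
  obtain ⟨M', hM'⟩ : ∃ M', M' = 2 * M + K * 1 + K * (0 + 3 * C) + 2 * R0 := ⟨_, rfl⟩
  have hM'n : 0 ≤ M' := by
    have : 0 ≤ K * (0 + 3 * C) := by nlinarith
    linarith
  obtain ⟨R1, hR1⟩ : ∃ R1, R1 = 3 * (K * C) + M := ⟨_, rfl⟩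
  have hR1n : 0 ≤ R1 := by linarith
  have hM1n : ∀ K₁ C₁ : ℝ, 1 ≤ K₁ → 0 ≤ C₁ → 1 ≤ K * K₁ ∧ 0 ≤ K * (C₁ + 3 * C) ∧
      0 ≤ N (K * K₁) (K * (C₁ + 3 * C) + 2 * R1) + R1 := by
    intro K₁ C₁ h1 h2
    have h3 : 1 ≤ K * K₁ := one_le_mul_of_one_le_of_one_le hK h1
    have h4 : 0 ≤ K * (C₁ + 3 * C) := mul_nonneg hK0 (by linarith)
    have := hN _ _ h3 (show 0 ≤ K * (C₁ + 3 * C) + 2 * R1 by linarith)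
    exact ⟨h3, h4, by linarith⟩
  refine ⟨fun K₁ C₁ => K * ((N (K * K₁) (K * (C₁ + 3 * C) + 2 * R1) + R1) + M') + 3 * C, ?_, ?_⟩
  · intro K₁ C₁ h1 h2
    obtain ⟨_, _, h3⟩ := hM1n K₁ C₁ h1 h2
    have : 0 ≤ K * ((N (K * K₁) (K * (C₁ + 3 * C) + 2 * R1) + R1) + M') :=
      mul_nonneg hK0 (by linarith)
    simp only
    linarith
  intro X Y _ _ hX hY q hq e x hx
  obtain ⟨γ, hγ, hγM⟩ := hx
  obtain ⟨β, hβ⟩ := hY (q e) (q x)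
  refine ⟨β, hβ, ?_⟩
  choose r hr using hq.2
  have hLn : 0 ≤ dist (q e) (q x) := dist_nonneg
  have hβq : IsQuasiGeodesicOn 1 0 (Icc 0 (dist (q e) (q x))) β := by
    intro s hs t ht
    rw [hβ.1.2 s hs t ht]; simp
  have hβl := aux_lift hK hC le_rfl le_rfl hq.1 hβq (τ := fun s => r (β s)) (fun s => hr _)
  have hrq : ∀ z : X, dist (r (q z)) z ≤ R0 := by
    intro z
    have h1 := aux_qi_upper hK hq.1 (r (q z)) z
    have h2 := hr (q z)
    rw [dist_comm] at h2
    have := mul_le_mul_of_nonneg_left (show dist (q (r (q z))) (q z) + C ≤ 2 * C by linarith) hK0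
    linarith
  have hn0 : dist (r (β 0)) (γ 0) ≤ R0 := by rw [hβ.2.1, hγ.2.1]; exact hrq e
  have hnL : dist (r (β (dist (q e) (q x)))) (γ (dist e x)) ≤ R0 := by
    rw [hβ.2.2, hγ.2.2]; exact hrq x
  have hex : 0 ≤ dist e x := dist_nonneg
  have hnear := aux_near_ends hN hγM (by linarith) (by nlinarith) hR0n hLn hβl
    ⟨γ 0, ⟨0, ⟨le_rfl, hex⟩, rfl⟩, hn0⟩ ⟨_, ⟨_, ⟨hex, le_rfl⟩, rfl⟩, hnL⟩
  rw [← hM] at hnear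
  have hconv := aux_converse hγ.1 (by linarith) (by nlinarith) hMn hR0n hLn hβl hn0 hnL hnear
  rw [← hM'] at hconv
  intro K₁ C₁ hK₁ hC₁ a b hab σ hσ hσa hσb s hs
  obtain ⟨h1, h2, h3⟩ := hM1n K₁ C₁ hK₁ hC₁
  have hσl := aux_lift hK hC hK₁ hC₁ hq.1 hσ (τ := fun s => r (σ s)) (fun s => hr _)
  have hend : ∀ u, σ u ∈ β '' Icc 0 (dist (q e) (q x)) →
      ∃ g ∈ γ '' Icc 0 (dist e x), dist (r (σ u)) g ≤ R1 := by
    rintro u ⟨t, ht, htu⟩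
    obtain ⟨g, hg, hgd⟩ := hnear t ht
    refine ⟨g, hg, ?_⟩
    rw [← htu]
    linarith
  obtain ⟨_, ⟨v, hv, rfl⟩, hvd⟩ := aux_near_ends hN hγM h1 h2 hR1n hab hσl (hend a hσa) (hend b hσb) s hs
  obtain ⟨u, hu, hud⟩ := hconv v hv
  refine ⟨β u, ⟨u, hu, rfl⟩, ?_⟩
  have h4 := dist_triangle (r (σ s)) (γ v) (r (β u))
  rw [dist_comm (γ v)] at h4
  have h5 := (hq.1 (r (σ s)) (r (β u))).2
  have h6 := dist_triangle4 (σ s) (q (r (σ s))) (q (r (β u))) (β u)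
  have h7 := hr (σ s)
  have h8 := hr (β u)
  rw [dist_comm] at h8
  have h9 := mul_le_mul_of_nonneg_left (h4.trans (add_le_add hvd hud)) hK0
  linarith

/-- image of a geodesic under a quasi-isometric embedding is quasi-geodesic -/
theorem aux_push {K C : ℝ} {q : X → Y} (hq : IsQIEmbedding K C q) {γ : ℝ → X} {e x : X}
    (hγ : IsGeodesicFromTo γ e x) :
    IsQuasiGeodesicOn K C (Icc 0 (dist e x)) (fun t => q (γ t)) := by
  intro s hs t ht
  have := hq (γ s) (γ t)
  rw [hγ.1.2 s hs t ht] at this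
  exact this

theorem aux_track {K C : ℝ} (hK : 1 ≤ K) (hC : 0 ≤ C) {q : X → Y} (hq : IsQIEmbedding K C q)
    {γ : ℝ → X} {β : ℝ → Y} {e x : X} {N' : ℝ → ℝ → ℝ}
    (hγ : IsGeodesicFromTo γ e x) (hβ : IsMorseGeodesicFromTo N' β (q e) (q x)) :
    ∀ t ∈ Icc 0 (dist e x), ∃ s ∈ Icc 0 (dist (q e) (q x)), dist (q (γ t)) (β s) ≤ N' K C := by
  intro t ht
  obtain ⟨_, ⟨s, hs, rfl⟩, hd⟩ := hβ.2 K C hK hC 0 (dist e x) dist_nonneg _ (aux_push hq hγ)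
    (by simp only [hγ.2.1]; exact ⟨0, ⟨le_rfl, dist_nonneg⟩, hβ.1.2.1⟩)
    (by simp only [hγ.2.2]; exact ⟨_, ⟨dist_nonneg, le_rfl⟩, hβ.1.2.2⟩) t ht
  exact ⟨s, hs, hd⟩

theorem aux_track' {K C : ℝ} (hK : 1 ≤ K) (hC : 0 ≤ C) {q : X → Y} (hq : IsQIEmbedding K C q)
    {γ : ℝ → X} {β : ℝ → Y} {e x : X} {N' : ℝ → ℝ → ℝ} (hN' : IsMorseGauge N')
    (hγ : IsGeodesicFromTo γ e x) (hβ : IsMorseGeodesicFromTo N' β (q e) (q x)) :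
    ∀ s ∈ Icc 0 (dist (q e) (q x)), ∃ t ∈ Icc 0 (dist e x),
      dist (q (γ t)) (β s) ≤ 2 * N' K C + K + C := by
  intro s hs
  obtain ⟨t, ht, hd⟩ := aux_converse hβ.1.1 hK hC (hN' K C hK hC) le_rfl dist_nonneg
    (aux_push hq hγ) (by simp [hγ.2.1, hβ.1.2.1]) (by simp [hγ.2.2, hβ.1.2.2])
    (fun t ht => by
      obtain ⟨s, hs, h⟩ := aux_track hK hC hq hγ hβ t ht
      exact ⟨_, ⟨s, hs, rfl⟩, h⟩) s hs
  exact ⟨t, ht, by linarith⟩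

theorem aux_mono {K C : ℝ} (hK : 1 ≤ K) (hC : 0 ≤ C) {q : X → Y} (hq : IsQIEmbedding K C q)
    {γ : ℝ → X} {β : ℝ → Y} {e x : X} {N' : ℝ → ℝ → ℝ} (hN' : IsMorseGauge N')
    (hγ : IsGeodesicFromTo γ e x) (hβ : IsMorseGeodesicFromTo N' β (q e) (q x)) :
    ∀ s t, 0 ≤ s → s ≤ t → t ≤ dist e x →
      (t - s) / K - ((5 * N' K C + K + 2 * C) + K * (K * (5 * N' K C + K + 2 * C)) + C) ≤
        dist (q e) (q (γ t)) - dist (q e) (q (γ s)) ∧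
      dist (q e) (q (γ t)) - dist (q e) (q (γ s)) ≤ K * (t - s) + C := by
  intro s t hs0 hst htL
  have hK0 : 0 < K := by linarith
  set D := N' K C with hD
  have hDn : 0 ≤ D := hN' K C hK hC
  have hp := aux_push hq hγ
  have hs : s ∈ Icc 0 (dist e x) := ⟨hs0, by linarith⟩
  have ht : t ∈ Icc 0 (dist e x) := ⟨by linarith, htL⟩
  have hcmp : ∀ u ∈ Icc 0 (dist e x), ∀ v ∈ Icc 0 (dist e x),
      dist (q (γ u)) (q (γ v)) ≤ 4 * D + |dist (q e) (q (γ u)) - dist (q e) (q (γ v))| := by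
    intro u hu v hv
    obtain ⟨u', hu', hud⟩ := aux_track hK hC hq hγ hβ u hu
    obtain ⟨v', hv', hvd⟩ := aux_track hK hC hq hγ hβ v hv
    have h1 := aux_param hβ.1 hu' hud
    have h2 := aux_param hβ.1 hv' hvd
    have h3 := hβ.1.1.2 u' hu' v' hv'
    have h4 := dist_triangle4 (q (γ u)) (β u') (β v') (q (γ v))
    rw [dist_comm (β v')] at h4
    have h5 : |u' - v'| ≤ 2 * D + |dist (q e) (q (γ u)) - dist (q e) (q (γ v))| := by
      have e1 := abs_le.1 h1
      have e2 := abs_le.1 h2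
      have e3 := abs_le.1 (le_refl |dist (q e) (q (γ u)) - dist (q e) (q (γ v))|)
      rw [abs_le]; constructor <;> linarith
    linarith
  have hup : ∀ u ∈ Icc 0 (dist e x), ∀ v ∈ Icc 0 (dist e x),
      |dist (q e) (q (γ u)) - dist (q e) (q (γ v))| ≤ K * |u - v| + C := by
    intro u hu v hv
    have h1 := (hp u hu v hv).2
    have h2 : |dist (q e) (q (γ u)) - dist (q e) (q (γ v))| ≤ dist (q (γ u)) (q (γ v)) := by
      rw [dist_comm (q e), dist_comm (q e)]
      exact abs_dist_sub_le _ _ _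
    exact h2.trans h1
  have hW : 0 ≤ 5 * D + K + 2 * C := by linarith
  have hKW : 0 ≤ K * (K * (5 * D + K + 2 * C)) := by positivity
  have hu1 := hup t ht s hs
  rw [abs_of_nonneg (by linarith : 0 ≤ t - s)] at hu1
  refine ⟨?_, (le_abs_self _).trans hu1⟩
  have hlow := (hp t ht s hs).1
  rw [abs_of_nonneg (by linarith : 0 ≤ t - s)] at hlow
  by_cases hcase : dist (q e) (q (γ s)) ≤ dist (q e) (q (γ t))
  · have h1 := hcmp t ht s hs
    rw [abs_of_nonneg (by linarith : 0 ≤ dist (q e) (q (γ t)) - dist (q e) (q (γ s)))] at h1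
    linarith
  push Not at hcase
  have hex : ∃ u, t ≤ u ∧ u ≤ dist e x ∧
      |dist (q e) (q (γ u)) - dist (q e) (q (γ s))| ≤ K + C + D := by
    by_cases h1 : dist (q e) (q (γ t)) ≤ dist (q e) (q (γ s)) - D
    · obtain ⟨s', hs', hsd⟩ := aux_track hK hC hq hγ hβ s hs
      have h2 := abs_le.1 (aux_param hβ.1 hs' hsd)
      obtain ⟨u, hu, hud⟩ := aux_ivt (fun u => dist (q e) (q (γ u))) t (dist e x) K C
        (dist (q e) (q (γ s)) - D) htL hK0.le
        (fun u hu v hv => hup u ⟨ht.1.trans hu.1, hu.2⟩ v ⟨ht.1.trans hv.1, hv.2⟩) h1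
        (by simp only [hγ.2.2]; linarith [hs'.2])
      refine ⟨u, hu.1, hu.2, ?_⟩
      have := abs_le.1 hud
      rw [abs_le]; constructor <;> linarith
    · push Not at h1
      refine ⟨t, le_rfl, htL, ?_⟩
      rw [abs_le]; constructor <;> linarith
  obtain ⟨u, htu, huL, hud⟩ := hex
  have hu : u ∈ Icc 0 (dist e x) := ⟨ht.1.trans htu, huL⟩
  have h1 := hcmp u hu s hs
  have h2 := (hp u hu s hs).1
  rw [abs_of_nonneg (by linarith : 0 ≤ u - s)] at h2
  have h3 : (u - s) / K ≤ 5 * D + K + 2 * C := by linarith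
  have h4 : (t - s) / K ≤ (u - s) / K := by gcongr
  have h5 : t - s ≤ K * (5 * D + K + 2 * C) := by
    have := h4.trans h3
    rw [div_le_iff₀ hK0] at this
    linarith
  have h6 := mul_le_mul_of_nonneg_left h5 hK0.le
  have h7 := abs_le.1 hu1
  linarith

theorem aux_compare (hX : GeodesicSpace X) (hY : GeodesicSpace Y) {K C : ℝ} (hK : 1 ≤ K)
    (hC : 0 ≤ C) {q : X → Y} (hq : IsQIEmbedding K C q) {e : X} {N N' : ℝ → ℝ → ℝ}
    (hN : IsMorseGauge N) (hN' : IsMorseGauge N')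
    (hs : ∀ x ∈ morseStratum N e, q x ∈ morseStratum N' (q e)) :
    ∃ c : ℝ, 0 ≤ c ∧ ∀ x ∈ morseStratum N e, ∃ h : ℝ → ℝ, h 0 = 0 ∧
      (∀ s t, 0 ≤ s → s ≤ t → t ≤ dist e x →
        (t - s) / K - c ≤ h t - h s ∧ h t - h s ≤ K * (t - s) + c) ∧
      ∀ y ∈ morseStratum N e, |gprod (q e) (q x) (q y) - h (gprod e x y)| ≤ c := by
  have hK0 : 0 < K := by linarith
  obtain ⟨D, hD⟩ : ∃ D, D = N 3 0 := ⟨_, rfl⟩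
  obtain ⟨D1, hD1⟩ : ∃ D1, D1 = N' K C := ⟨_, rfl⟩
  obtain ⟨D3, hD3⟩ : ∃ D3, D3 = N' 3 0 := ⟨_, rfl⟩
  have hDn : 0 ≤ D := by rw [hD]; exact hN _ _ (by norm_num) le_rfl
  have hD1n : 0 ≤ D1 := by rw [hD1]; exact hN' _ _ hK hC
  have hD3n : 0 ≤ D3 := by rw [hD3]; exact hN' _ _ (by norm_num) le_rfl
  obtain ⟨D2, hD2⟩ : ∃ D2, D2 = 2 * D1 + K + C := ⟨_, rfl⟩
  have hD2n : 0 ≤ D2 := by linarith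
  obtain ⟨m, hm⟩ : ∃ m, m = (5 * D1 + K + 2 * C) + K * (K * (5 * D1 + K + 2 * C)) + C := ⟨_, rfl⟩
  have hmn : 0 ≤ m := by rw [hm]; positivity
  obtain ⟨E1, hE1⟩ : ∃ E1, E1 = 2 * D1 + K * (4 * D) + C := ⟨_, rfl⟩
  have hE1n : 0 ≤ E1 := by rw [hE1]; positivity
  obtain ⟨E2, hE2⟩ : ∃ E2, E2 = K * (4 * D3 + 2 * D2 + C) := ⟨_, rfl⟩
  have hE2n : 0 ≤ E2 := by rw [hE2]; positivity
  have hKE2 : 0 ≤ K * E2 := by positivity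
  refine ⟨m + C + E1 + D1 + D2 + K * E2, by linarith, ?_⟩
  intro x hx
  obtain ⟨γ, hγ⟩ := hx
  obtain ⟨β, hβ⟩ := hs x ⟨γ, hγ⟩
  have hmono := aux_mono hK hC hq hN' hγ.1 hβ
  rw [← hD1, ← hm] at hmono
  refine ⟨fun t => dist (q e) (q (γ t)), by simp [hγ.1.2.1], ?_, ?_⟩
  · intro s t h1 h2 h3
    have := hmono s t h1 h2 h3
    constructor <;> linarith [this.1, this.2]
  intro y hy
  obtain ⟨γ', hγ'⟩ := hy
  obtain ⟨β', hβ'⟩ := hs y ⟨γ', hγ'⟩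
  have ha0 := gprod_nonneg' e x y
  have hax := gprod_le_left e x y
  have hay := gprod_le_right e x y
  have ha0' := gprod_nonneg' (q e) (q x) (q y)
  have hax' := gprod_le_left (q e) (q x) (q y)
  have hay' := gprod_le_right (q e) (q x) (q y)
  set a := gprod e x y with ha
  set a' := gprod (q e) (q x) (q y) with ha'
  rw [abs_le]
  constructor
  · obtain ⟨s, hs, hsd⟩ := aux_track hK hC hq hγ.1 hβ a ⟨ha0, hax⟩
    obtain ⟨t, ht, htd⟩ := aux_track hK hC hq hγ'.1 hβ' a ⟨ha0, hay⟩
    rw [← hD1] at hsd htd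
    have h1 := aux_fellow hX hγ hγ' a ha0 le_rfl
    rw [← hD] at h1
    have h2 := (hq (γ a) (γ' a)).2
    have h3 := mul_le_mul_of_nonneg_left h1 hK0.le
    have h4 := dist_triangle4 (β s) (q (γ a)) (q (γ' a)) (β' t)
    rw [dist_comm (β s)] at h4
    have h5 : dist (β s) (β' t) ≤ E1 := by rw [dist_comm (q (γ a))] at h4; rw [dist_comm (q (γ a)) (β s)] at hsd; linarith [dist_comm (β s) (q (γ a)), dist_triangle4 (β s) (q (γ a)) (q (γ' a)) (β' t)]
    have h6 := aux_gprod_lower hβ.1 hβ'.1 hs ht h5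
    have h7 := abs_le.1 (aux_param hβ.1 hs hsd)
    have h8 := abs_le.1 (aux_param hβ'.1 ht (le_refl (dist (β s) (β' t))))
    have h9 := abs_le.1 (aux_param hβ.1 hs (le_of_eq (dist_self (β s))))
    simp only
    linarith
  · obtain ⟨s, hs, hsd⟩ := aux_track' hK hC hq hN' hγ.1 hβ a' ⟨ha0', hax'⟩
    obtain ⟨t, ht, htd⟩ := aux_track' hK hC hq hN' hγ'.1 hβ' a' ⟨ha0', hay'⟩
    rw [← hD1, ← hD2] at hsd htd
    have h1 := aux_fellow hY hβ hβ' a' ha0' le_rfl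
    rw [← hD3] at h1
    have h2 := aux_qi_upper hK hq (γ s) (γ' t)
    have h3 := dist_triangle4 (q (γ s)) (β a') (β' a') (q (γ' t))
    rw [dist_comm (β' a')] at h3
    have h4 := mul_le_mul_of_nonneg_left
      (show dist (q (γ s)) (q (γ' t)) + C ≤ 4 * D3 + 2 * D2 + C by linarith) hK0.le
    have h5 : dist (γ s) (γ' t) ≤ E2 := by linarith
    have h6 := aux_gprod_lower hγ.1 hγ'.1 hs ht h5
    have h8 := abs_le.1 (aux_param hγ'.1 ht h5)
    have h9 := abs_le.1 (aux_param hγ.1 hs (le_of_eq (dist_self (γ s))))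
    have h7 := abs_le.1 (aux_param hβ.1 ⟨ha0', hax'⟩ hsd)
    have h10 : s ≤ a + E2 := by linarith
    simp only
    rcases le_total s a with hsa | hsa
    · have h11 := (hmono s a hs.1 hsa hax).1
      have h12 : 0 ≤ (a - s) / K := div_nonneg (by linarith) hK0.le
      linarith
    · have h11 := (hmono a s ha0 hsa hs.2).2
      have h12 := mul_le_mul_of_nonneg_left (show s - a ≤ E2 by linarith) hK0.le
      linarith

theorem aux_equiv_iff {e : X} {f g : ℕ → X} : EquivAtInf e f g ↔
    ∀ r : ℝ, ∃ n₀ : ℕ, ∀ n m, n₀ ≤ n → n₀ ≤ m → r ≤ gprod e (f n) (g m) := by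
  unfold EquivAtInf
  rw [tendsto_atTop]
  simp only [eventually_atTop_prod_self]

theorem aux_equiv_symm {e : X} {f g : ℕ → X} (h : EquivAtInf e f g) : EquivAtInf e g f := by
  rw [aux_equiv_iff] at h ⊢
  intro r
  obtain ⟨n₀, hn⟩ := h r
  refine ⟨n₀, fun n m h1 h2 => ?_⟩
  rw [gprod_comm']
  exact hn m n h2 h1

theorem aux_equiv_trans (hX : GeodesicSpace X) {N : ℝ → ℝ → ℝ} {e : X} {f g h : ℕ → X}
    (hf : ∀ n, f n ∈ morseStratum N e) (hg : ∀ n, g n ∈ morseStratum N e)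
    (hh : ∀ n, h n ∈ morseStratum N e) (h1 : EquivAtInf e f g) (h2 : EquivAtInf e g h) :
    EquivAtInf e f h := by
  rw [aux_equiv_iff] at h1 h2 ⊢
  intro r
  obtain ⟨n₁, hn₁⟩ := h1 (r + 4 * N 3 0)
  obtain ⟨n₂, hn₂⟩ := h2 (r + 4 * N 3 0)
  refine ⟨max n₁ n₂, fun n m h3 h4 => ?_⟩
  have h5 := aux_four hX (hf n) (hg (max n₁ n₂)) (hh m)
  have h6 := le_min (hn₁ n (max n₁ n₂) ((le_max_left _ _).trans h3) (le_max_left _ _))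
    (hn₂ (max n₁ n₂) m (le_max_right _ _) ((le_max_right _ _).trans h4))
  linarith

theorem aux_mk_eq (hX : GeodesicSpace X) {N : ℝ → ℝ → ℝ} {e : X}
    (f g : BSeq (morseStratum N e) e) :
    SeqBoundary.mk f = SeqBoundary.mk g ↔ EquivAtInf e f.1 g.1 := by
  constructor
  · intro h
    have h' := Quot.eqvGen_exact h
    clear h
    induction h' with
    | rel x y h => exact h
    | refl x => exact x.2.2
    | symm x y _ ih => exact aux_equiv_symm ih
    | trans x y z _ _ ih1 ih2 => exact aux_equiv_trans hX x.2.1 y.2.1 z.2.1 ih1 ih2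
  · intro h
    exact Quot.sound h

theorem aux_five (hX : GeodesicSpace X) {N : ℝ → ℝ → ℝ} {e x y z w : X} {r : ℝ}
    (hN : 0 ≤ N 3 0)
    (hx : x ∈ morseStratum N e) (hy : y ∈ morseStratum N e) (hz : z ∈ morseStratum N e)
    (hw : w ∈ morseStratum N e) (h1 : r ≤ gprod e x y) (h2 : r ≤ gprod e y z)
    (h3 : r ≤ gprod e z w) : r - 8 * N 3 0 ≤ gprod e x w := by
  have h4 := aux_four hX hx hy hz
  have h5 := aux_four hX hx hz hw
  have h6 := le_min h1 h2
  have h7 : r - 4 * N 3 0 ≤ min (gprod e x z) (gprod e z w) := le_min (by linarith) (by linarith)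
  linarith

theorem aux_bgp (hX : GeodesicSpace X) {N : ℝ → ℝ → ℝ} (hN : IsMorseGauge N) {e : X}
    (f g : BSeq (morseStratum N e) e)
    (hne : bGP (morseStratum N e) e (SeqBoundary.mk f) (SeqBoundary.mk g) ≠ ⊤) :
    ∃ n₀ : ℕ, ∀ n m, n₀ ≤ n → n₀ ≤ m → |gprod e (f.1 n) (g.1 m) -
      (bGP (morseStratum N e) e (SeqBoundary.mk f) (SeqBoundary.mk g)).toReal| ≤
        1 + 8 * N 3 0 := by
  have hNn : 0 ≤ N 3 0 := hN _ _ (by norm_num) le_rfl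
  have hle : seqGP e f.1 g.1 ≤
      bGP (morseStratum N e) e (SeqBoundary.mk f) (SeqBoundary.mk g) :=
    le_sSup ⟨f, g, rfl, rfl, rfl⟩
  have h0 : (0 : EReal) ≤ seqGP e f.1 g.1 := by
    unfold seqGP
    apply le_liminf_of_le
    · isBoundedDefault
    · refine Eventually.of_forall (fun p => ?_)
      exact_mod_cast gprod_nonneg' _ _ _
  have hbot : bGP (morseStratum N e) e (SeqBoundary.mk f) (SeqBoundary.mk g) ≠ ⊥ := by
    intro h
    rw [h] at hle
    have := h0.trans hle
    simp at this
  have hcoe := EReal.coe_toReal hne hbot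
  set B := (bGP (morseStratum N e) e (SeqBoundary.mk f) (SeqBoundary.mk g)).toReal with hB
  have hlow : ∃ n₀ : ℕ, ∀ n m, n₀ ≤ n → n₀ ≤ m →
      B - 1 - 8 * N 3 0 ≤ gprod e (f.1 n) (g.1 m) := by
    have hlt : ((B - 1 : ℝ) : EReal) <
        bGP (morseStratum N e) e (SeqBoundary.mk f) (SeqBoundary.mk g) := by
      rw [← hcoe]; exact_mod_cast (by linarith : B - 1 < B)
    obtain ⟨_, ⟨f', g', hf', hg', rfl⟩, hlt'⟩ := lt_sSup_iff.1 hlt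
    have hev := eventually_lt_of_lt_liminf hlt'
    rw [eventually_atTop_prod_self] at hev
    obtain ⟨n₁, hn₁⟩ := hev
    obtain ⟨n₂, hn₂⟩ := aux_equiv_iff.1 ((aux_mk_eq hX f f').1 hf'.symm) (B - 1)
    obtain ⟨n₃, hn₃⟩ := aux_equiv_iff.1 ((aux_mk_eq hX g' g).1 hg') (B - 1)
    have m1 : n₁ ≤ max n₁ (max n₂ n₃) := le_max_left _ _
    have m2 : n₂ ≤ max n₁ (max n₂ n₃) := (le_max_left _ _).trans (le_max_right _ _)
    have m3 : n₃ ≤ max n₁ (max n₂ n₃) := (le_max_right _ _).trans (le_max_right _ _)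
    refine ⟨max n₁ (max n₂ n₃), fun n m hn hm => ?_⟩
    have h1 := hn₁ _ _ m1 m1
    simp only at h1
    have h1' : B - 1 < _ := EReal.coe_lt_coe_iff.1 h1
    exact aux_five hX hNn (f.2.1 n) (f'.2.1 _) (g'.2.1 _) (g.2.1 m)
      (hn₂ n _ (m2.trans hn) m2) h1'.le (hn₃ _ m m3 (m3.trans hm))
  have hupp : ∃ n₀ : ℕ, ∀ n m, n₀ ≤ n → n₀ ≤ m →
      gprod e (f.1 n) (g.1 m) ≤ B + 1 + 8 * N 3 0 := by
    have hlt : seqGP e f.1 g.1 < ((B + 1 : ℝ) : EReal) := by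
      refine hle.trans_lt ?_
      rw [← hcoe]; exact_mod_cast (by linarith : B < B + 1)
    have hfr := frequently_lt_of_liminf_lt (by isBoundedDefault) hlt
    rw [frequently_atTop] at hfr
    obtain ⟨n₂, hn₂⟩ := aux_equiv_iff.1 (show EquivAtInf e f.1 f.1 from f.2.2)
      (B + 1 + 8 * N 3 0)
    obtain ⟨n₃, hn₃⟩ := aux_equiv_iff.1 (show EquivAtInf e g.1 g.1 from g.2.2)
      (B + 1 + 8 * N 3 0)
    refine ⟨max n₂ n₃, fun n m hn hm => ?_⟩
    obtain ⟨⟨n', m'⟩, hnm, hlt'⟩ := hfr (max n₂ n₃, max n₂ n₃)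
    simp only at hlt'
    have hlt'' : gprod e (f.1 n') (g.1 m') < B + 1 := EReal.coe_lt_coe_iff.1 hlt'
    obtain ⟨hn', hm'⟩ := Prod.mk_le_mk.1 hnm
    by_contra hcon
    push Not at hcon
    have := aux_five hX hNn (f.2.1 n') (f.2.1 n) (g.2.1 m) (g.2.1 m')
      (hn₂ n' n ((le_max_left _ _).trans hn') ((le_max_left _ _).trans hn)) hcon.le
      (hn₃ m m' ((le_max_right _ _).trans hm) ((le_max_right _ _).trans hm'))
    linarith
  obtain ⟨n₁, hn₁⟩ := hlow
  obtain ⟨n₂, hn₂⟩ := hupp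
  refine ⟨max n₁ n₂, fun n m hn hm => ?_⟩
  have h1 := hn₁ n m ((le_max_left _ _).trans hn) ((le_max_left _ _).trans hm)
  have h2 := hn₂ n m ((le_max_right _ _).trans hn) ((le_max_right _ _).trans hm)
  rw [abs_le]; constructor <;> linarith

theorem aux_visual_ne_top {S : Set X} {e : X} {d : SeqBoundary S e → SeqBoundary S e → ℝ}
    (hd : IsVisualMetric S e d) {ξ ζ : SeqBoundary S e} (hne : ξ ≠ ζ) : bGP S e ξ ζ ≠ ⊤ := by
  obtain ⟨h0, hsymm, htri, hz, ε, hε, k₁, hk₁, k₂, hk₂, hk⟩ := hd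
  intro h
  have h1 := (hk ξ ζ).2
  rw [h] at h1
  simp only [visGauge, if_true, mul_zero] at h1
  exact hne ((hz ξ ζ).1 (le_antisymm h1 (h0 ξ ζ)))

theorem aux_homeo {M κ α β : ℝ} (hM : 0 < M) (hκ : 0 < κ) (hα : 0 < α) (hβ : 0 < β) :
    IsHomeoIci (fun t => M * ((κ * t) ^ α + (κ * t) ^ β)) := by
  refine ⟨?_, ?_, ?_, ?_, ?_⟩
  · apply Continuous.continuousOn
    have h1 : Continuous fun t : ℝ => (κ * t) ^ α :=
      (continuous_const.mul continuous_id).rpow_const (fun _ => Or.inr hα.le)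
    have h2 : Continuous fun t : ℝ => (κ * t) ^ β :=
      (continuous_const.mul continuous_id).rpow_const (fun _ => Or.inr hβ.le)
    exact continuous_const.mul (h1.add h2)
  · intro s hs t ht hst
    have hs' : 0 ≤ κ * s := mul_nonneg hκ.le hs
    have h1 : κ * s < κ * t := mul_lt_mul_of_pos_left hst hκ
    have h2 := Real.rpow_lt_rpow hs' h1 hα
    have h3 := Real.rpow_lt_rpow hs' h1 hβ
    exact mul_lt_mul_of_pos_left (add_lt_add h2 h3) hM
  · simp [hα.ne', hβ.ne']
  · have h0 : Tendsto (fun t : ℝ => κ * t) atTop atTop := tendsto_id.const_mul_atTop hκ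
    have h1 := (tendsto_rpow_atTop hα).comp h0
    have h2 := (tendsto_rpow_atTop hβ).comp h0
    exact (h1.atTop_add_atTop h2).const_mul_atTop hM
  · intro t ht
    have : 0 ≤ κ * t := mul_nonneg hκ.le ht
    positivity

/-- Pure real arithmetic of the quasi-symmetry estimate. -/
theorem aux_qs_arith {K c ε ε' k₁ k₂ k₁' k₂' A B A' B' dxy dxz dxy' dxz' : ℝ}
    (hK : 1 ≤ K) (hε : 0 < ε) (hε' : 0 < ε') (hk₁ : 0 < k₁) (hk₂ : 0 < k₂)
    (hk₁' : 0 < k₁') (hk₂' : 0 < k₂')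
    (h1 : k₁ * Real.exp (-ε * A) ≤ dxy) (h2 : dxz ≤ k₂ * Real.exp (-ε * B))
    (h2' : 0 < dxz)
    (h3 : dxy' ≤ k₂' * Real.exp (-ε' * A')) (h4 : k₁' * Real.exp (-ε' * B') ≤ dxz')
    (hAB : min ((A - B) / K) (K * (A - B)) - c ≤ A' - B') :
    dxy' / dxz' ≤ (k₂' / k₁' * Real.exp (ε' * c)) *
      ((k₂ / k₁ * (dxy / dxz)) ^ (ε' / (ε * K)) + (k₂ / k₁ * (dxy / dxz)) ^ (ε' * K / ε)) := by
  have hK0 : 0 < K := by linarith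
  have hr : Real.exp (-ε * (A - B)) ≤ k₂ / k₁ * (dxy / dxz) := by
    rw [div_mul_div_comm, le_div_iff₀ (by positivity)]
    have e1 : Real.exp (-ε * (A - B)) * Real.exp (-ε * B) = Real.exp (-ε * A) := by
      rw [← Real.exp_add]; congr 1; ring
    calc Real.exp (-ε * (A - B)) * (k₁ * dxz)
        ≤ Real.exp (-ε * (A - B)) * (k₁ * (k₂ * Real.exp (-ε * B))) := by gcongr
      _ = k₂ * (k₁ * (Real.exp (-ε * (A - B)) * Real.exp (-ε * B))) := by ring
      _ = k₂ * (k₁ * Real.exp (-ε * A)) := by rw [e1]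
      _ ≤ k₂ * dxy := by gcongr
  have hdxz' : 0 < dxz' := lt_of_lt_of_le (by positivity) h4
  have hr' : dxy' / dxz' ≤ k₂' / k₁' * Real.exp (-ε' * (A' - B')) := by
    rw [div_le_iff₀ hdxz']
    have e1 : Real.exp (-ε' * (A' - B')) * Real.exp (-ε' * B') = Real.exp (-ε' * A') := by
      rw [← Real.exp_add]; congr 1; ring
    calc dxy' ≤ k₂' * Real.exp (-ε' * A') := h3
      _ = k₂' / k₁' * Real.exp (-ε' * (A' - B')) * (k₁' * Real.exp (-ε' * B')) := by
          rw [← e1]; field_simp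
      _ ≤ _ := by gcongr
  have hexp : Real.exp (-ε' * (A' - B')) ≤ Real.exp (ε' * c) *
      (Real.exp (-ε * (A - B)) ^ (ε' / (ε * K)) + Real.exp (-ε * (A - B)) ^ (ε' * K / ε)) := by
    rw [← Real.exp_mul, ← Real.exp_mul, mul_add, ← Real.exp_add, ← Real.exp_add]
    have e1 : -ε * (A - B) * (ε' / (ε * K)) = - ε' * ((A - B) / K) := by field_simp
    have e2 : -ε * (A - B) * (ε' * K / ε) = - ε' * (K * (A - B)) := by field_simp
    rw [e1, e2]
    rcases min_choice ((A - B) / K) (K * (A - B)) with h | h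
    · rw [h] at hAB
      have h5 := mul_le_mul_of_nonneg_left hAB hε'.le
      have h6 : Real.exp (-ε' * (A' - B')) ≤ Real.exp (ε' * c + -ε' * ((A - B) / K)) :=
        Real.exp_le_exp.2 (by linarith)
      have := Real.exp_pos (ε' * c + -ε' * (K * (A - B)))
      linarith
    · rw [h] at hAB
      have h5 := mul_le_mul_of_nonneg_left hAB hε'.le
      have h6 : Real.exp (-ε' * (A' - B')) ≤ Real.exp (ε' * c + -ε' * (K * (A - B))) :=
        Real.exp_le_exp.2 (by linarith)
      have := Real.exp_pos (ε' * c + -ε' * ((A - B) / K))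
      linarith
  calc dxy' / dxz' ≤ k₂' / k₁' * Real.exp (-ε' * (A' - B')) := hr'
    _ ≤ k₂' / k₁' * (Real.exp (ε' * c) * (Real.exp (-ε * (A - B)) ^ (ε' / (ε * K)) +
          Real.exp (-ε * (A - B)) ^ (ε' * K / ε))) := by gcongr
    _ ≤ k₂' / k₁' * (Real.exp (ε' * c) * ((k₂ / k₁ * (dxy / dxz)) ^ (ε' / (ε * K)) +
          (k₂ / k₁ * (dxy / dxz)) ^ (ε' * K / ε))) := by gcongr
    _ = _ := by ring

/-- passing the comparison from approximants to limits -/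
theorem aux_min_arith {K c p p' a b a' b' A B A' B' : ℝ} (hK : 1 ≤ K)
    (ha : |a - A| ≤ p) (hb : |b - B| ≤ p) (ha' : |a' - A'| ≤ p') (hb' : |b' - B'| ≤ p')
    (h : min ((a - b) / K) (K * (a - b)) - c ≤ a' - b') :
    min ((A - B) / K) (K * (A - B)) - (c + 2 * (K * p) + 2 * p') ≤ A' - B' := by
  have hK0 : 0 < K := by linarith
  rw [abs_le] at ha hb ha' hb'
  have hp : 0 ≤ p := by linarith
  have h1 : A - B ≤ (a - b) + 2 * p := by linarith
  have h2 : (A - B) / K ≤ ((a - b) + 2 * p) / K := by gcongr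
  have h3 : K * (A - B) ≤ K * ((a - b) + 2 * p) := by gcongr
  have h4 : (2 * p) / K ≤ 2 * (K * p) := by
    rw [div_le_iff₀ hK0]
    nlinarith [mul_nonneg hp (show 0 ≤ K - 1 by linarith), mul_nonneg (mul_nonneg hp (show 0 ≤ K - 1 by linarith)) hK0.le]
  rw [add_div] at h2
  have h5 : min ((A - B) / K) (K * (A - B)) ≤ min ((a - b) / K) (K * (a - b)) + 2 * (K * p) := by
    rw [← min_add_add_right]
    exact min_le_min (by linarith) (by linarith)
  linarith

theorem aux_diff (hX : GeodesicSpace X) (hY : GeodesicSpace Y) {K C : ℝ} (hK : 1 ≤ K)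
    (hC : 0 ≤ C) {q : X → Y} (hq : IsQIEmbedding K C q) {e : X} {N N' : ℝ → ℝ → ℝ}
    (hN : IsMorseGauge N) (hN' : IsMorseGauge N')
    (hs : ∀ x ∈ morseStratum N e, q x ∈ morseStratum N' (q e)) :
    ∃ c : ℝ, (∀ x ∈ morseStratum N e, ∀ y ∈ morseStratum N e,
        gprod e x y / K - c ≤ gprod (q e) (q x) (q y) ∧
        gprod (q e) (q x) (q y) ≤ K * gprod e x y + c) ∧
      ∀ x ∈ morseStratum N e, ∀ y ∈ morseStratum N e, ∀ z ∈ morseStratum N e,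
        min ((gprod e x y - gprod e x z) / K) (K * (gprod e x y - gprod e x z)) - c ≤
          gprod (q e) (q x) (q y) - gprod (q e) (q x) (q z) := by
  obtain ⟨c, hc, hcomp⟩ := aux_compare hX hY hK hC hq hN hN' hs
  refine ⟨3 * c, ?_, ?_⟩
  · intro x hx y hy
    obtain ⟨h, h0, hm, hg⟩ := hcomp x hx
    have h1 := hm 0 _ le_rfl (gprod_nonneg' e x y) (gprod_le_left _ _ _)
    have h2 := abs_le.1 (hg y hy)
    rw [h0, sub_zero, sub_zero] at h1
    constructor <;> linarith [h1.1, h1.2]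
  · intro x hx y hy z hz
    obtain ⟨h, h0, hm, hg⟩ := hcomp x hx
    have h2 := abs_le.1 (hg y hy)
    have h3 := abs_le.1 (hg z hz)
    rcases le_total (gprod e x z) (gprod e x y) with hle | hle
    · have h1 := hm _ _ (gprod_nonneg' e x z) hle (gprod_le_left _ _ _)
      have := min_le_left ((gprod e x y - gprod e x z) / K) (K * (gprod e x y - gprod e x z))
      linarith [h1.1]
    · have h1 := hm _ _ (gprod_nonneg' e x y) hle (gprod_le_left _ _ _)
      have := min_le_right ((gprod e x y - gprod e x z) / K) (K * (gprod e x y - gprod e x z))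
      linarith [h1.2]

end Aux

/-- a `(K,C)`-quasi-isometry sends sequences converging at infinity
in `X^(N)_e` to sequences converging at infinity in `Y^(N')_{q e}`, preserves
equivalence, and induces an injective boundary map which is a quasi-symmetry
onto its image for any visual metrics. -/
theorem statement4 (N : ℝ → ℝ → ℝ) (hN : IsMorseGauge N)
    (K C : ℝ) (hK : 1 ≤ K) (hC : 0 ≤ C) :
    ∃ N' : ℝ → ℝ → ℝ, IsMorseGauge N' ∧
      ∀ (X Y : Type*) [MetricSpace X] [MetricSpace Y],
        GeodesicSpace X → GeodesicSpace Y →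
        ∀ q : X → Y, IsQuasiIsometry K C q → ∀ e : X,
          (∀ f : ℕ → X, (∀ n, f n ∈ morseStratum N e) → ConvAtInf e f →
              (∀ n, q (f n) ∈ morseStratum N' (q e)) ∧
                ConvAtInf (q e) (fun n => q (f n))) ∧
          (∀ f g : ℕ → X, (∀ n, f n ∈ morseStratum N e) →
              (∀ n, g n ∈ morseStratum N e) →
              ConvAtInf e f → ConvAtInf e g → EquivAtInf e f g →
              EquivAtInf (q e) (fun n => q (f n)) (fun n => q (g n))) ∧
          ∃ Q : SeqBoundary (morseStratum N e) e →
              SeqBoundary (morseStratum N' (q e)) (q e),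
            (∀ (f : BSeq (morseStratum N e) e)
                (g : BSeq (morseStratum N' (q e)) (q e)),
                (∀ n, g.1 n = q (f.1 n)) →
                Q (SeqBoundary.mk f) = SeqBoundary.mk g) ∧
            Function.Injective Q ∧
            ∀ d d', IsVisualMetric (morseStratum N e) e d →
              IsVisualMetric (morseStratum N' (q e)) (q e) d' →
              IsQuasiSymmetryOnto d d' Q := by
  obtain ⟨N', hN', hgauge⟩ := aux_gauge N hN K C hK hC
  refine ⟨N', hN', ?_⟩
  intro X Y _ _ hX hY q hq e
  have hK0 : 0 < K := by linarith
  have hs := hgauge X Y hX hY q hq e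
  obtain ⟨c, hlin, hdiff⟩ := aux_diff hX hY hK hC hq.1 hN hN' hs
  have hequiv : ∀ f g : ℕ → X, (∀ n, f n ∈ morseStratum N e) →
      (∀ n, g n ∈ morseStratum N e) →
      (EquivAtInf e f g ↔ EquivAtInf (q e) (fun n => q (f n)) (fun n => q (g n))) := by
    intro f g hf hg
    rw [aux_equiv_iff, aux_equiv_iff]
    constructor
    · intro h r
      obtain ⟨n₀, hn⟩ := h (K * (r + c))
      refine ⟨n₀, fun n m h1 h2 => ?_⟩
      have h3 := hn n m h1 h2
      have h4 := (hlin _ (hf n) _ (hg m)).1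
      have h5 : r + c ≤ gprod e (f n) (g m) / K := by
        rw [le_div_iff₀ hK0]; linarith
      linarith
    · intro h r
      obtain ⟨n₀, hn⟩ := h (K * r + c)
      refine ⟨n₀, fun n m h1 h2 => ?_⟩
      have h3 := hn n m h1 h2
      have h4 := (hlin _ (hf n) _ (hg m)).2
      have h5 : K * r ≤ K * gprod e (f n) (g m) := by linarith
      exact le_of_mul_le_mul_left h5 hK0
  let P : BSeq (morseStratum N e) e → BSeq (morseStratum N' (q e)) (q e) := fun f =>
    ⟨fun n => q (f.1 n), fun n => hs _ (f.2.1 n), (hequiv f.1 f.1 f.2.1 f.2.1).1 f.2.2⟩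
  let Q : SeqBoundary (morseStratum N e) e → SeqBoundary (morseStratum N' (q e)) (q e) :=
    Quot.lift (fun f => SeqBoundary.mk (P f))
      (fun f g h => (aux_mk_eq hY (P f) (P g)).2 ((hequiv f.1 g.1 f.2.1 g.2.1).1 h))
  have hQ : ∀ f, Q (SeqBoundary.mk f) = SeqBoundary.mk (P f) := fun f => rfl
  have hinj : Function.Injective Q := by
    intro ξ ζ
    obtain ⟨f, rfl⟩ := Quot.exists_rep ξ
    obtain ⟨g, rfl⟩ := Quot.exists_rep ζ
    intro h
    have h1 := (aux_mk_eq hY (P f) (P g)).1 h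
    exact (aux_mk_eq hX f g).2 ((hequiv f.1 g.1 f.2.1 g.2.1).2 h1)
  refine ⟨?_, ?_, Q, ?_, hinj, ?_⟩
  · intro f hf hc
    exact ⟨fun n => hs _ (hf n), (hequiv f f hf hf).1 hc⟩
  · intro f g hf hg _ _ h
    exact (hequiv f g hf hg).1 h
  · intro f g h
    rw [hQ]
    congr 1
    apply Subtype.ext
    funext n
    exact (h n).symm
  intro d d' hd hd'
  refine ⟨hinj, ?_⟩
  have hdc := hd
  have hdc' := hd'
  obtain ⟨h0, hsymm, htri, hz, ε, hε, k₁, hk₁, k₂, hk₂, hk⟩ := hdc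
  obtain ⟨h0', hsymm', htri', hz', ε', hε', k₁', hk₁', k₂', hk₂', hk'⟩ := hdc'
  obtain ⟨c', hc'⟩ : ∃ c', c' = c + 2 * (K * (1 + 8 * N 3 0)) + 2 * (1 + 8 * N' 3 0) := ⟨_, rfl⟩
  refine ⟨_, aux_homeo (M := k₂' / k₁' * Real.exp (ε' * c')) (κ := k₂ / k₁)
    (α := ε' / (ε * K)) (β := ε' * K / ε) (by positivity) (by positivity) (by positivity)
    (by positivity), ?_⟩
  intro x y z hxy hxz hyz
  have t1 := aux_visual_ne_top hd hxy
  have t2 := aux_visual_ne_top hd hxz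
  have t3 := aux_visual_ne_top hd' (fun h => hxy (hinj h))
  have t4 := aux_visual_ne_top hd' (fun h => hxz (hinj h))
  have g1 := (hk x y).1
  have g2 := (hk x z).2
  have g3 := (hk' (Q x) (Q y)).2
  have g4 := (hk' (Q x) (Q z)).1
  simp only [visGauge, t1, t2, t3, t4, if_false] at g1 g2 g3 g4
  have g5 : 0 < d x z := lt_of_le_of_ne (h0 x z) (fun h => hxz ((hz x z).1 h.symm))
  refine aux_qs_arith hK hε hε' hk₁ hk₂ hk₁' hk₂' g1 g2 g5 g3 g4 ?_
  clear g1 g2 g3 g4 g5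
  obtain ⟨f, rfl⟩ := Quot.exists_rep x
  obtain ⟨g, rfl⟩ := Quot.exists_rep y
  obtain ⟨h, rfl⟩ := Quot.exists_rep z
  obtain ⟨n₁, hn₁⟩ := aux_bgp hX hN f g t1
  obtain ⟨n₂, hn₂⟩ := aux_bgp hX hN f h t2
  obtain ⟨n₃, hn₃⟩ := aux_bgp hY hN' (P f) (P g) t3
  obtain ⟨n₄, hn₄⟩ := aux_bgp hY hN' (P f) (P h) t4
  obtain ⟨n, l1, l2, l3, l4⟩ : ∃ n, n₁ ≤ n ∧ n₂ ≤ n ∧ n₃ ≤ n ∧ n₄ ≤ n :=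
    ⟨n₁ + n₂ + n₃ + n₄, by omega, by omega, by omega, by omega⟩
  rw [hc']
  exact aux_min_arith hK (hn₁ n n l1 l1) (hn₂ n n l2 l2) (hn₃ n n l3 l3) (hn₄ n n l4 l4)
    (hdiff _ (f.2.1 n) _ (g.2.1 n) _ (h.2.1 n))
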